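/- arXiv:1212.5481 — 2 statements merged into one kernel-verified Lean document; each statement's English description precedes it below -/
import Mathlib

section
/- Let n ≥ 1, let X₁,…,Xₙ and U be normed spaces and X := X₁ × … × Xₙ. For i, j ∈ {1,…,n} let χ_{ij} : [0,∞) → [0,∞) be either identically zero or of class K with χ_{ii} = 0, let χ_i ∈ K, α_i positive definite, V_i : X_i → [0,∞), and g_i : X × U → X_i, and suppose that for all x = (x₁,…,xₙ) ∈ X, ξ ∈ U and all i: V_i(g_i(x,ξ)) ≤ max{α_i(V_i(x_i)), max_j χ_{ij}(V_j(x_j)), χ_i(‖ξ‖)}. Let σ₁,…,σₙ ∈ K∞ satisfy max_j χ_{ij}(σ_j(r)) < σ_i(r) for all i and all r > 0. Define V(x) := max_i σ_i⁻¹(V_i(x_i)), χ(r) := max_i σ_i⁻¹(χ_i(r)), η(r) := max_{i ≠ j} σ_i⁻¹(χ_{ij}(σ_j(r))), and g(x,ξ) := (g₁(x,ξ),…,gₙ(x,ξ)). Then η(r) < r for all r > 0, and for every function α* of class K with α*(r) ≥ max_i σ_i⁻¹(α_i(σ_i(r))) for all r ≥ 0, setting α := max{α*, η}, one has V(g(x,ξ))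 ≤ max{α(V(x)), χ(‖ξ‖)} for all x ∈ X and ξ ∈ U. -/
open Set Filter Topology

/-- A class `K` function. -/
def ClassK (γ : ℝ → ℝ) : Prop :=
  ContinuousOn γ (Set.Ici 0) ∧ StrictMonoOn γ (Set.Ici 0) ∧ γ 0 = 0

/-- A class `K∞` function. -/
def ClassKinf (γ : ℝ → ℝ) : Prop :=
  ClassK γ ∧ Filter.Tendsto γ Filter.atTop Filter.atTop

/-- A positive definite function. -/
def PosDef (φ : ℝ → ℝ) : Prop :=
  ContinuousOn φ (Set.Ici 0) ∧ φ 0 = 0 ∧ ∀ s > (0:ℝ), 0 < φ s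

/-- The composite Lyapunov function `V(x) = max_i σ_i⁻¹(V_i(x_i))`. -/
def Vcomp {n : ℕ} {X : Fin (n + 1) → Type*} (σinv : Fin (n + 1) → ℝ → ℝ)
    (V : ∀ i, X i → ℝ) (x : ∀ i, X i) : ℝ :=
  Finset.univ.sup' Finset.univ_nonempty fun i => σinv i (V i (x i))

/-- The composite external gain `χ(r) = max_i σ_i⁻¹(χ_i(r))`. -/
def chiComp {n : ℕ} (σinv : Fin (n + 1) → ℝ → ℝ)
    (χu : Fin (n + 1) → ℝ → ℝ) (r : ℝ) : ℝ :=
  Finset.univ.sup' Finset.univ_nonempty fun i => σinv i (χu i r)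

/-- `η(r) = max_{i ≠ j} σ_i⁻¹(χ_{ij}(σ_j(r)))` (diagonal entries replaced
by `0`). -/
def etaComp {n : ℕ} (σ σinv : Fin (n + 1) → ℝ → ℝ)
    (χg : Fin (n + 1) → Fin (n + 1) → ℝ → ℝ) (r : ℝ) : ℝ :=
  Finset.univ.sup' Finset.univ_nonempty fun i =>
    Finset.univ.sup' Finset.univ_nonempty fun j =>
      if j = i then 0 else σinv i (χg i j (σ j r))

theorem ClassK.monotoneOn {γ : ℝ → ℝ} (h : ClassK γ) : MonotoneOn γ (Set.Ici 0) :=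
  h.2.1.monotoneOn

theorem ClassK.nonneg {γ : ℝ → ℝ} (h : ClassK γ) {r : ℝ} (hr : 0 ≤ r) : 0 ≤ γ r :=
  h.2.2.symm.le.trans (h.monotoneOn (Set.mem_Ici.2 le_rfl) hr hr)

/-- A nonnegative right inverse of a class `K` function on `[0, ∞)` is strictly monotone there. -/
theorem ClassK.strictMonoOn_rightInverse {γ γinv : ℝ → ℝ} (h : ClassK γ)
    (hright : ∀ s ≥ (0:ℝ), γ (γinv s) = s) (hnonneg : ∀ s ≥ (0:ℝ), 0 ≤ γinv s) :
    StrictMonoOn γinv (Set.Ici 0) := by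
  intro s hs t ht hst
  by_contra! hle
  have := h.monotoneOn (hnonneg t ht) (hnonneg s hs) hle
  rw [hright s hs, hright t ht] at this
  exact hst.not_ge this

/-- the discrete-dynamics core of the small-gain theorem: the
jump estimates of the subsystems' ISS-Lyapunov functions combine, along an
Ω-path `σ`, into a jump estimate for `V(x) = max_i σ_i⁻¹(V_i(x_i))`. -/
theorem stmt_17 (n : ℕ) {U : Type*} [NormedAddCommGroup U]
    (X : Fin (n + 1) → Type*) [∀ i, NormedAddCommGroup (X i)]
    (χg : Fin (n + 1) → Fin (n + 1) → ℝ → ℝ)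
    (hχg : ∀ i j, (∀ r : ℝ, χg i j r = 0) ∨ ClassK (χg i j))
    (hdiag : ∀ i, ∀ r : ℝ, χg i i r = 0)
    (χu : Fin (n + 1) → ℝ → ℝ) (hχu : ∀ i, ClassK (χu i))
    (α : Fin (n + 1) → ℝ → ℝ) (hα : ∀ i, PosDef (α i))
    (V : ∀ i, X i → ℝ) (hV : ∀ i x, 0 ≤ V i x)
    (g : ∀ i : Fin (n + 1), (∀ j, X j) → U → X i)
    (hjump : ∀ (x : ∀ j, X j) (ξ : U) (i),
      V i (g i x ξ) ≤ max (max (α i (V i (x i)))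
        (Finset.univ.sup' Finset.univ_nonempty fun j => χg i j (V j (x j))))
        (χu i ‖ξ‖))
    (σ σinv : Fin (n + 1) → ℝ → ℝ) (hσ : ∀ i, ClassKinf (σ i))
    (hσinv1 : ∀ i, ∀ r ≥ (0:ℝ), σinv i (σ i r) = r)
    (hσinv2 : ∀ i, ∀ s ≥ (0:ℝ), σ i (σinv i s) = s)
    (hσinv3 : ∀ i, ∀ s ≥ (0:ℝ), 0 ≤ σinv i s)
    (hΩ : ∀ i, ∀ r > (0:ℝ),
      (Finset.univ.sup' Finset.univ_nonempty fun j => χg i j (σ j r)) < σ i r) :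
    (∀ r > (0:ℝ), etaComp σ σinv χg r < r) ∧
    ∀ αs : ℝ → ℝ, ClassK αs →
      (∀ r ≥ (0:ℝ),
        (Finset.univ.sup' Finset.univ_nonempty fun i => σinv i (α i (σ i r)))
          ≤ αs r) →
      ∀ (x : ∀ j, X j) (ξ : U),
        Vcomp σinv V (fun j => g j x ξ) ≤
          max (max (αs (Vcomp σinv V x)) (etaComp σ σinv χg (Vcomp σinv V x)))
            (chiComp σinv χu ‖ξ‖) := by
  have hχg_mono : ∀ i j, MonotoneOn (χg i j) (Set.Ici 0) := by
    intro i j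
    rcases hχg i j with h | h
    · intro a _ b _ _
      rw [h, h]
    · exact h.monotoneOn
  have hχg_nonneg : ∀ i j, ∀ r ≥ (0:ℝ), 0 ≤ χg i j r := by
    intro i j r hr
    rcases hχg i j with h | h
    · exact (h r).ge
    · exact h.nonneg hr
  have hσinv_strictMono : ∀ i, StrictMonoOn (σinv i) (Set.Ici 0) := fun i =>
    (hσ i).1.strictMonoOn_rightInverse (hσinv2 i) (hσinv3 i)
  have hσinv_mono : ∀ i, MonotoneOn (σinv i) (Set.Ici 0) := fun i =>
    (hσinv_strictMono i).monotoneOn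
  have hσinv_zero : ∀ i, σinv i 0 = 0 := by
    intro i
    have := hσinv1 i 0 le_rfl
    rwa [(hσ i).1.2.2] at this
  refine ⟨fun r hr => ?_, fun αs hαs hαs_ge x ξ => ?_⟩
  · simp only [etaComp, Finset.sup'_lt_iff]
    intro i _ j _
    split_ifs
    · exact hr
    · have hσj := (hσ j).1.nonneg hr.le
      have hlt : χg i j (σ j r) < σ i r :=
        (Finset.sup'_lt_iff _).1 (hΩ i r hr) j (Finset.mem_univ j)
      calc σinv i (χg i j (σ j r)) < σinv i (σ i r) :=
            hσinv_strictMono i (hχg_nonneg i j _ hσj) ((hσ i).1.nonneg hr.le) hlt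
        _ = r := hσinv1 i r hr.le
  · set v := Vcomp σinv V x
    have hle_v : ∀ j, σinv j (V j (x j)) ≤ v := fun j =>
      Finset.le_sup' (fun i => σinv i (V i (x i))) (Finset.mem_univ j)
    have hv_nonneg : 0 ≤ v := (hσinv3 0 _ (hV 0 (x 0))).trans (hle_v 0)
    have hV_le : ∀ j, V j (x j) ≤ σ j v := fun j => by
      rw [← hσinv2 j _ (hV j (x j))]
      exact (hσ j).1.monotoneOn (hσinv3 j _ (hV j (x j))) hv_nonneg (hle_v j)
    have heta : ∀ i j, (if j = i then 0 else σinv i (χg i j (σ j v))) ≤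
        etaComp σ σinv χg v := fun i j =>
      (Finset.le_sup' (fun j => if j = i then 0 else σinv i (χg i j (σ j v)))
        (Finset.mem_univ j)).trans
      (Finset.le_sup' (fun i => Finset.univ.sup' Finset.univ_nonempty fun j =>
        if j = i then 0 else σinv i (χg i j (σ j v))) (Finset.mem_univ i))
    refine Finset.sup'_le _ _ fun i _ => ?_
    have hg := hV i (g i x ξ)
    rcases le_max_iff.1 (hjump x ξ i) with h | h
    · refine le_max_of_le_left ?_
      rcases le_max_iff.1 h with h | h
      · refine le_max_of_le_left ?_
        have hw := hσinv3 i _ (hV i (x i))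
        calc σinv i (V i (g i x ξ)) ≤ σinv i (α i (V i (x i))) := hσinv_mono i hg (hg.trans h) h
          _ = σinv i (α i (σ i (σinv i (V i (x i))))) := by rw [hσinv2 i _ (hV i (x i))]
          _ ≤ αs (σinv i (V i (x i))) :=
            (Finset.le_sup' (fun k => σinv k (α k (σ k (σinv i (V i (x i))))))
              (Finset.mem_univ i)).trans (hαs_ge _ hw)
          _ ≤ αs v := hαs.monotoneOn hw hv_nonneg (hle_v i)
      · refine le_max_of_le_right ?_
        obtain ⟨j, -, hj⟩ := (Finset.le_sup'_iff _).1 h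
        have hle : V i (g i x ξ) ≤ χg i j (σ j v) :=
          hj.trans (hχg_mono i j (hV j (x j)) ((hσ j).1.nonneg hv_nonneg) (hV_le j))
        refine (hσinv_mono i hg (hg.trans hle) hle).trans (le_trans ?_ (heta i j))
        split_ifs with hji
        · subst hji
          rw [hdiag, hσinv_zero]
        · exact le_rfl
    · refine le_max_of_le_right ((hσinv_mono i hg (hg.trans h) h).trans ?_)
      exact Finset.le_sup' (fun i => σinv i (χu i ‖ξ‖)) (Finset.mem_univ i)
end

section
/- Let m ≥ 1 and a_j > 0, b_j > 0 for j = 1,…,m, and define σ : [0,∞) → [0,∞) by σ(t) = max_{j=1,…,m} a_j·t^{b_j}. Then σ is of class K∞ (in particular a bijection of [0,∞)), its inverse is σ⁻¹(s) = min_{j=1,…,m} (s/a_j)^{1/b_j}, and for every c > 0 one has σ⁻¹(c·σ(t)) ≤ k·t for all t ≥ 0, where k := max_{j=1,…,m} c^{1/b_j}. -/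
open Set Filter Topology Real

/-- `σ(t) = max_j a_j·t^{b_j}`, a finite maximum of power functions. -/
noncomputable def powMax {m : ℕ} (a b : Fin (m + 1) → ℝ) (t : ℝ) : ℝ :=
  Finset.univ.sup' Finset.univ_nonempty fun j => a j * t ^ (b j)

/-- `τ(s) = min_j (s/a_j)^{1/b_j}`, the candidate inverse of `powMax a b`. -/
noncomputable def powMaxInv {m : ℕ} (a b : Fin (m + 1) → ℝ) (s : ℝ) : ℝ :=
  Finset.univ.inf' Finset.univ_nonempty fun j => (s / a j) ^ (1 / b j)

section PowMax

variable {m : ℕ} {a b : Fin (m + 1) → ℝ}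

theorem exists_powMax_eq (a b : Fin (m + 1) → ℝ) (t : ℝ) :
    ∃ j, powMax a b t = a j * t ^ b j := by
  obtain ⟨j, -, hj⟩ := Finset.exists_mem_eq_sup' Finset.univ_nonempty fun j => a j * t ^ b j
  exact ⟨j, hj⟩

theorem exists_powMaxInv_eq (a b : Fin (m + 1) → ℝ) (s : ℝ) :
    ∃ j, powMaxInv a b s = (s / a j) ^ (1 / b j) := by
  obtain ⟨j, -, hj⟩ :=
    Finset.exists_mem_eq_inf' Finset.univ_nonempty fun j => (s / a j) ^ (1 / b j)
  exact ⟨j, hj⟩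

theorem le_powMax (a b : Fin (m + 1) → ℝ) (t : ℝ) (j : Fin (m + 1)) :
    a j * t ^ b j ≤ powMax a b t :=
  Finset.le_sup' (fun j => a j * t ^ b j) (Finset.mem_univ j)

theorem powMaxInv_le (a b : Fin (m + 1) → ℝ) (s : ℝ) (j : Fin (m + 1)) :
    powMaxInv a b s ≤ (s / a j) ^ (1 / b j) :=
  Finset.inf'_le (fun j => (s / a j) ^ (1 / b j)) (Finset.mem_univ j)

theorem powMax_nonneg (ha : ∀ j, 0 < a j) {t : ℝ} (ht : 0 ≤ t) : 0 ≤ powMax a b t :=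
  (mul_nonneg (ha 0).le (rpow_nonneg ht _)).trans (le_powMax a b t 0)

theorem powMaxInv_nonneg (ha : ∀ j, 0 < a j) {s : ℝ} (hs : 0 ≤ s) : 0 ≤ powMaxInv a b s := by
  obtain ⟨j, hj⟩ := exists_powMaxInv_eq a b s
  exact hj ▸ rpow_nonneg (div_nonneg hs (ha j).le) _

theorem continuousOn_powMax (hb : ∀ j, 0 < b j) : ContinuousOn (powMax a b) (Ici 0) :=
  ContinuousOn.finset_sup'_apply Finset.univ_nonempty fun j _ =>
    ((continuous_id.rpow_const fun _ => Or.inr (hb j).le).const_mul (a j)).continuousOn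

theorem strictMonoOn_powMax (ha : ∀ j, 0 < a j) (hb : ∀ j, 0 < b j) :
    StrictMonoOn (powMax a b) (Ici 0) := by
  intro x hx y _ hxy
  obtain ⟨j, hj⟩ := exists_powMax_eq a b x
  rw [hj]
  exact (mul_lt_mul_of_pos_left (rpow_lt_rpow hx hxy (hb j)) (ha j)).trans_le (le_powMax a b y j)

theorem powMax_zero (hb : ∀ j, 0 < b j) : powMax a b 0 = 0 := by
  obtain ⟨j, hj⟩ := exists_powMax_eq a b 0
  rw [hj, zero_rpow (hb j).ne', mul_zero]

theorem tendsto_powMax_atTop (ha : ∀ j, 0 < a j) (hb : ∀ j, 0 < b j) :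
    Tendsto (powMax a b) atTop atTop :=
  tendsto_atTop_mono (fun t => le_powMax a b t 0)
    ((tendsto_rpow_atTop (hb 0)).const_mul_atTop (ha 0))

theorem classKinf_powMax (ha : ∀ j, 0 < a j) (hb : ∀ j, 0 < b j) : ClassKinf (powMax a b) :=
  ⟨⟨continuousOn_powMax hb, strictMonoOn_powMax ha hb, powMax_zero hb⟩,
    tendsto_powMax_atTop ha hb⟩

theorem mul_rpow_div_rpow_one_div {a b s : ℝ} (ha : 0 < a) (hb : 0 < b) (hs : 0 ≤ s) :
    a * ((s / a) ^ (1 / b)) ^ b = s := by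
  rw [one_div, rpow_inv_rpow (div_nonneg hs ha.le) hb.ne', mul_div_cancel₀ s ha.ne']

theorem powMax_powMaxInv (ha : ∀ j, 0 < a j) (hb : ∀ j, 0 < b j) {s : ℝ} (hs : 0 ≤ s) :
    powMax a b (powMaxInv a b s) = s := by
  apply le_antisymm
  · obtain ⟨j, hj⟩ := exists_powMax_eq a b (powMaxInv a b s)
    rw [hj]
    calc a j * powMaxInv a b s ^ b j ≤ a j * ((s / a j) ^ (1 / b j)) ^ b j :=
          mul_le_mul_of_nonneg_left
            (rpow_le_rpow (powMaxInv_nonneg ha hs) (powMaxInv_le a b s j) (hb j).le) (ha j).le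
      _ = s := mul_rpow_div_rpow_one_div (ha j) (hb j) hs
  · obtain ⟨j, hj⟩ := exists_powMaxInv_eq a b s
    calc s = a j * powMaxInv a b s ^ b j := by
          rw [hj, mul_rpow_div_rpow_one_div (ha j) (hb j) hs]
      _ ≤ powMax a b (powMaxInv a b s) := le_powMax a b _ j

theorem powMaxInv_powMax (ha : ∀ j, 0 < a j) (hb : ∀ j, 0 < b j) {t : ℝ} (ht : 0 ≤ t) :
    powMaxInv a b (powMax a b t) = t :=
  (strictMonoOn_powMax ha hb).injOn (powMaxInv_nonneg ha (powMax_nonneg ha ht)) ht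
    (powMax_powMaxInv ha hb (powMax_nonneg ha ht))

theorem bijOn_powMax (ha : ∀ j, 0 < a j) (hb : ∀ j, 0 < b j) :
    BijOn (powMax a b) (Ici 0) (Ici 0) :=
  InvOn.bijOn (f' := powMaxInv a b)
    ⟨fun _ ht => powMaxInv_powMax ha hb ht, fun _ hs => powMax_powMaxInv ha hb hs⟩
    (fun _ ht => powMax_nonneg ha ht) (fun _ hs => powMaxInv_nonneg ha hs)

theorem powMaxInv_mul_powMax_le (ha : ∀ j, 0 < a j) (hb : ∀ j, 0 < b j) {c t : ℝ}
    (hc : 0 ≤ c) (ht : 0 ≤ t) :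
    powMaxInv a b (c * powMax a b t) ≤
      (Finset.univ.sup' Finset.univ_nonempty fun j => c ^ (1 / b j)) * t := by
  obtain ⟨j, hj⟩ := exists_powMax_eq a b t
  calc powMaxInv a b (c * powMax a b t) ≤ (c * powMax a b t / a j) ^ (1 / b j) :=
        powMaxInv_le a b _ j
    _ = (c * t ^ b j) ^ (1 / b j) := by
        rw [hj, mul_left_comm, mul_div_cancel_left₀ _ (ha j).ne']
    _ = c ^ (1 / b j) * t := by
        rw [mul_rpow hc (rpow_nonneg ht _), one_div, rpow_rpow_inv ht (hb j).ne']
    _ ≤ _ := mul_le_mul_of_nonneg_right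
        (Finset.le_sup' (fun j => c ^ (1 / b j)) (Finset.mem_univ j)) ht

end PowMax

/-- a finite maximum of power functions `σ(t) = max_j a_j·t^{b_j}`
is of class `K∞`, a bijection of `[0,∞)` with inverse
`σ⁻¹(s) = min_j (s/a_j)^{1/b_j}`, and `σ⁻¹(c·σ(t)) ≤ k·t` where
`k = max_j c^{1/b_j}`. -/
theorem stmt_18 (m : ℕ) (a b : Fin (m + 1) → ℝ)
    (ha : ∀ j, 0 < a j) (hb : ∀ j, 0 < b j) :
    ClassKinf (powMax a b) ∧
    Set.BijOn (powMax a b) (Set.Ici 0) (Set.Ici 0) ∧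
    (∀ s ≥ (0:ℝ), powMax a b (powMaxInv a b s) = s) ∧
    (∀ t ≥ (0:ℝ), powMaxInv a b (powMax a b t) = t) ∧
    ∀ c > (0:ℝ), ∀ t ≥ (0:ℝ),
      powMaxInv a b (c * powMax a b t) ≤
        (Finset.univ.sup' Finset.univ_nonempty fun j => c ^ (1 / b j)) * t :=
  ⟨classKinf_powMax ha hb, bijOn_powMax ha hb, fun _ hs => powMax_powMaxInv ha hb hs,
    fun _ ht => powMaxInv_powMax ha hb ht,
    fun _ hc _ ht => powMaxInv_mul_powMax_le ha hb hc.le ht⟩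
end
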